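/- (Corollary 1, factorized envelope.) Let c, d ∈ ℝ and s = (sₓ, s_y, s_z) ∈ ℝ³. The set { c²·s_z + d²·e_z + 2cd·(sₓ·e_y − s_y·eₓ) : e = (eₓ, e_y, e_z) ∈ ℝ³, ‖e‖ ≤ 1 } equals the closed interval [ c²·s_z − |d|·√(d² + 4c²(sₓ² + s_y²)), c²·s_z + |d|·√(d² + 4c²(sₓ² + s_y²)) ]. -/

import Mathlib

/-- The image of the closed unit ball under `inner ℝ v` is `[-‖v‖, ‖v‖]`. -/
theorem exists_norm_le_one_inner_eq_iff {E : Type*} [NormedAddCommGroup E]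
    [InnerProductSpace ℝ E] (v : E) (t : ℝ) :
    (∃ e : E, ‖e‖ ≤ 1 ∧ inner ℝ v e = t) ↔ |t| ≤ ‖v‖ := by
  constructor
  · rintro ⟨e, he, rfl⟩
    exact (abs_real_inner_le_norm v e).trans (mul_le_of_le_one_right (norm_nonneg v) he)
  · intro ht
    rcases eq_or_ne v 0 with rfl | hv
    · exact ⟨0, by simp, by simpa [eq_comm] using ht⟩
    · have hpos : 0 < ‖v‖ := norm_pos_iff.mpr hv
      refine ⟨(t / ‖v‖ ^ 2) • v, ?_, ?_⟩
      · rw [norm_smul, Real.norm_eq_abs, abs_div, abs_of_pos (pow_pos hpos 2), div_mul_eq_mul_div,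
          div_le_one (pow_pos hpos 2), sq]
        gcongr
      · rw [real_inner_smul_right, real_inner_self_eq_norm_sq]
        field_simp

/-- Corollary 1, factorized envelope.
The set of values `c²·s_z + d²·e_z + 2cd·(sₓ·e_y − s_y·eₓ)`, as `e` ranges over the
closed unit ball of ℝ³, is exactly the closed interval
`[c²·s_z − |d|·√(d² + 4c²(sₓ²+s_y²)), c²·s_z + |d|·√(d² + 4c²(sₓ²+s_y²))]`. -/
theorem factorized_envelope (c d sx sy sz : ℝ) :
    {z : ℝ | ∃ e : EuclideanSpace ℝ (Fin 3), ‖e‖ ≤ 1 ∧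
        z = c ^ 2 * sz + d ^ 2 * e 2 + 2 * c * d * (sx * e 1 - sy * e 0)}
      = Set.Icc
          (c ^ 2 * sz - |d| * Real.sqrt (d ^ 2 + 4 * c ^ 2 * (sx ^ 2 + sy ^ 2)))
          (c ^ 2 * sz + |d| * Real.sqrt (d ^ 2 + 4 * c ^ 2 * (sx ^ 2 + sy ^ 2))) := by
  have hnorm : ‖!₂[-(2 * c * d * sy), 2 * c * d * sx, d ^ 2]‖ =
      |d| * √(d ^ 2 + 4 * c ^ 2 * (sx ^ 2 + sy ^ 2)) := by
    rw [EuclideanSpace.norm_eq, ← Real.sqrt_sq_eq_abs, ← Real.sqrt_mul (sq_nonneg d)]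
    congr 1
    simp only [Fin.sum_univ_three, Real.norm_eq_abs, sq_abs, Matrix.cons_val]
    ring
  ext z
  rw [← hnorm, ← Set.mem_Icc_iff_abs_le, abs_sub_comm,
    ← exists_norm_le_one_inner_eq_iff, Set.mem_ofPred_eq]
  refine exists_congr fun e => and_congr_right fun _ => ?_
  simp only [PiLp.inner_apply, Fin.sum_univ_three, RCLike.inner_apply, conj_trivial,
    Matrix.cons_val]
  constructor <;> intro h <;> linarith
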